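/- Let A have columns α_j (j=1,…,n) normalized or not. For any ε ∈ (0,1) and a ∈ (0,1), P(μ(A) ≥ ε) ≤ (n(n−1)/2) [ P(|⟨α_j, α_k⟩| ≥ aε) + 2 P(‖α_j‖₂² ≤ a) ] for any fixed j ≠ k, provided the columns are exchangeable (identically distributed pairs). In particular, for a Gaussian random matrix with i.i.d. N(0,1/m) entries, P(μ(A) ≥ ε) ≤ (n(n−1)/2) [ exp(−m a²ε²/(4(1 + aε/2))) + exp(−m(1−a)²/4) ]. -/

import Mathlib

open MeasureTheory ProbabilityTheory Matrix
open scoped ENNReal NNReal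

/-- Mutual coherence of a matrix. -/
noncomputable def mutualCoherence {m n : ℕ} (A : Matrix (Fin m) (Fin n) ℝ) : ℝ :=
  ⨆ p : {p : Fin n × Fin n // p.1 ≠ p.2},
    |(fun i => A i p.1.1) ⬝ᵥ (fun i => A i p.1.2)| /
      (Real.sqrt ((fun i => A i p.1.1) ⬝ᵥ (fun i => A i p.1.1)) *
       Real.sqrt ((fun i => A i p.1.2) ⬝ᵥ (fun i => A i p.1.2)))

lemma aux_card (n : ℕ) :
    ((Finset.univ.filter (fun p : Fin n × Fin n => p.1 < p.2)).card : ℝ≥0∞)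
      = (n : ℝ≥0∞) * (n - 1) / 2 := by
  have h1 : (Finset.univ.filter (fun p : Fin n × Fin n => p.1 < p.2)).card
      = (Finset.univ.filter (fun p : Fin n × Fin n => p.2 < p.1)).card := by
    apply Finset.card_bij (fun p _ => p.swap)
    · simp
    · intro a _ b _ h
      exact Prod.swap_injective h
    · intro b hb
      exact ⟨b.swap, by simpa using hb, by simp⟩
  have h2 : (Finset.univ.filter (fun p : Fin n × Fin n => p.1 < p.2)).card +
      (Finset.univ.filter (fun p : Fin n × Fin n => p.2 < p.1)).card = n * (n - 1) := by
    rw [← Finset.card_union_of_disjoint]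
    · have : (Finset.univ.filter (fun p : Fin n × Fin n => p.1 < p.2)) ∪
        (Finset.univ.filter (fun p : Fin n × Fin n => p.2 < p.1)) =
          (Finset.univ : Finset (Fin n)).offDiag := by
        ext p
        simp [lt_or_lt_iff_ne]
      rw [this, Finset.offDiag_card]
      simp [Nat.mul_sub]
    · rw [Finset.disjoint_left]
      intro p hp hq
      simp at hp hq
      exact lt_asymm hp hq
  rw [← h1] at h2
  rw [ENNReal.eq_div_iff (by norm_num) (by norm_num)]
  have : (n : ℝ≥0∞) - 1 = ((n - 1 : ℕ) : ℝ≥0∞) := by simp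
  rw [this]
  norm_cast
  omega

lemma aux_coh {m n : ℕ} (hn : 2 ≤ n) (A : Matrix (Fin m) (Fin n) ℝ) {ε : ℝ}
    (h : ε ≤ mutualCoherence A) :
    ∃ p : Fin n × Fin n, p.1 < p.2 ∧ ε ≤ |(fun i => A i p.1) ⬝ᵥ (fun i => A i p.2)| /
      (Real.sqrt ((fun i => A i p.1) ⬝ᵥ (fun i => A i p.1)) *
       Real.sqrt ((fun i => A i p.2) ⬝ᵥ (fun i => A i p.2))) := by
  have : Nonempty {p : Fin n × Fin n // p.1 ≠ p.2} :=
    ⟨⟨(⟨0, by omega⟩, ⟨1, by omega⟩), by simp⟩⟩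
  unfold mutualCoherence at h
  obtain ⟨p, hp⟩ := exists_eq_ciSup_of_finite
    (f := fun p : {p : Fin n × Fin n // p.1 ≠ p.2} =>
    |(fun i => A i p.1.1) ⬝ᵥ (fun i => A i p.1.2)| /
      (Real.sqrt ((fun i => A i p.1.1) ⬝ᵥ (fun i => A i p.1.1)) *
       Real.sqrt ((fun i => A i p.1.2) ⬝ᵥ (fun i => A i p.1.2))))
  rw [← hp] at h
  rcases lt_or_gt_of_ne p.2 with h1 | h1
  · exact ⟨p.1, h1, h⟩
  · refine ⟨p.1.swap, h1, ?_⟩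
    simp only [Prod.fst_swap, Prod.snd_swap]
    rw [dotProduct_comm, mul_comm]
    exact h

lemma aux_union {m n : ℕ} (hn : 2 ≤ n) {ε : ℝ} {Ω : Type*} [MeasurableSpace Ω] (μ : Measure Ω)
    (A : Ω → Matrix (Fin m) (Fin n) ℝ) (B : ℝ≥0∞)
    (hB : ∀ j k : Fin n, j < k → μ {ω | ε ≤ |(fun i => A ω i j) ⬝ᵥ (fun i => A ω i k)| /
      (Real.sqrt ((fun i => A ω i j) ⬝ᵥ (fun i => A ω i j)) *
       Real.sqrt ((fun i => A ω i k) ⬝ᵥ (fun i => A ω i k)))} ≤ B) :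
    μ {ω | ε ≤ mutualCoherence (A ω)} ≤ ((n : ℝ≥0∞) * (n - 1) / 2) * B := by
  rw [← aux_card, ← nsmul_eq_mul, ← Finset.sum_const]
  refine le_trans (measure_mono ?_) (le_trans (measure_biUnion_finset_le
    (Finset.univ.filter (fun p : Fin n × Fin n => p.1 < p.2))
    (fun p => {ω | ε ≤ |(fun i => A ω i p.1) ⬝ᵥ (fun i => A ω i p.2)| /
      (Real.sqrt ((fun i => A ω i p.1) ⬝ᵥ (fun i => A ω i p.1)) *
       Real.sqrt ((fun i => A ω i p.2) ⬝ᵥ (fun i => A ω i p.2)))}))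
    (Finset.sum_le_sum fun p hp => hB p.1 p.2 (by simpa using hp)))
  intro ω hω
  obtain ⟨p, hp, hp'⟩ := aux_coh hn (A ω) hω
  simp only [Set.mem_iUnion]
  exact ⟨p, by simpa using hp, hp'⟩

lemma aux_tail {t : ℝ} (ht : 0 ≤ t) :
    gaussianReal 0 1 {z | t ≤ z ^ 2} ≤ ENNReal.ofReal (Real.exp (-t / 2)) := by
  set r := √t with hr
  have hr0 : 0 ≤ r := Real.sqrt_nonneg t
  have hrt : r ^ 2 = t := Real.sq_sqrt ht
  set c := ENNReal.ofReal (Real.exp (-t / 2)) with hc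
  have key : ∀ x s : ℝ, 0 ≤ x * s → s ^ 2 = t →
      gaussianPDF 0 1 (x + s) ≤ c * gaussianPDF 0 1 x := by
    intro x s hs hst
    rw [gaussianPDF, gaussianPDF, hc, ← ENNReal.ofReal_mul (Real.exp_nonneg _)]
    apply ENNReal.ofReal_le_ofReal
    rw [gaussianPDFReal, gaussianPDFReal, mul_left_comm, ← Real.exp_add]
    gcongr
    simp
    nlinarith
  have hplus : gaussianReal 0 1 (Set.Ici r) ≤ c * gaussianReal 0 1 (Set.Ici 0) := by
    rw [gaussianReal_apply 0 one_ne_zero, gaussianReal_apply 0 one_ne_zero,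
      ← lintegral_indicator measurableSet_Ici, ← lintegral_indicator measurableSet_Ici,
      ← lintegral_const_mul _ ((measurable_gaussianPDF 0 1).indicator measurableSet_Ici),
      ← lintegral_add_right_eq_self _ r]
    refine lintegral_mono fun x => ?_
    by_cases hx : 0 ≤ x
    · simp [Set.indicator, hx]
      exact key x r (by positivity) hrt
    · simp [Set.indicator, hx]
  have hminus : gaussianReal 0 1 (Set.Iic (-r)) ≤ c * gaussianReal 0 1 (Set.Iio 0) := by
    have := noAtoms_gaussianReal (μ := 0) (v := 1) one_ne_zero
    rw [← measure_congr (Iio_ae_eq_Iic (μ := gaussianReal 0 1) (a := -r))]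
    rw [gaussianReal_apply 0 one_ne_zero, gaussianReal_apply 0 one_ne_zero,
      ← lintegral_indicator measurableSet_Iio, ← lintegral_indicator measurableSet_Iio,
      ← lintegral_const_mul _ ((measurable_gaussianPDF 0 1).indicator measurableSet_Iio),
      ← lintegral_add_right_eq_self _ (-r)]
    refine lintegral_mono fun x => ?_
    by_cases hx : x < 0
    · simp only [Set.indicator, Set.mem_Iio, hx, add_lt_iff_neg_right, if_true]
      exact key x (-r) (by nlinarith) (by simpa using hrt)
    · simp [Set.indicator, hx]
  calc gaussianReal 0 1 {z | t ≤ z ^ 2}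
      ≤ gaussianReal 0 1 (Set.Ici r ∪ Set.Iic (-r)) := by
        refine measure_mono fun z hz => ?_
        have : r ≤ |z| := by
          rw [hr, ← Real.sqrt_sq_eq_abs]
          exact Real.sqrt_le_sqrt hz
        rcases le_abs.1 this with h | h
        · exact Or.inl h
        · exact Or.inr (by simp; linarith)
    _ ≤ _ := measure_union_le _ _
    _ ≤ c * gaussianReal 0 1 (Set.Ici 0) + c * gaussianReal 0 1 (Set.Iio 0) :=
        add_le_add hplus hminus
    _ = c := by
        rw [← mul_add, ← measure_union _ measurableSet_Iio]
        · simp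
        · rw [Set.disjoint_left]
          intro x hx hx'
          simp at hx hx'
          linarith

lemma aux_mgf {c : ℝ} (hc : 0 ≤ c) :
    ∫ x, Real.exp (-c * x ^ 2 / 2) ∂(gaussianReal 0 1) = (√(1 + c))⁻¹ := by
  rw [integral_gaussianReal_eq_integral_smul one_ne_zero]
  have : ∀ x : ℝ, gaussianPDFReal 0 1 x • Real.exp (-c * x ^ 2 / 2)
      = (√(2 * Real.pi))⁻¹ * Real.exp (-((1 + c) / 2) * x ^ 2) := by
    intro x
    rw [gaussianPDFReal, smul_eq_mul, mul_assoc, ← Real.exp_add]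
    congr 2
    · simp
    · simp only [NNReal.coe_one, sub_zero]
      ring
  simp_rw [this]
  rw [integral_const_mul, integral_gaussian, ← Real.sqrt_inv, ← Real.sqrt_mul (by positivity),
    ← Real.sqrt_inv]
  congr 1
  have := Real.pi_pos
  field_simp

lemma aux_core (k : ℕ) {ε : ℝ} (h0 : 0 < ε) (h1 : ε < 1) :
    (Measure.pi fun _ : Fin (k + 1) => gaussianReal 0 1)
      {x | ε ^ 2 * ∑ i, x i ^ 2 ≤ x 0 ^ 2} ≤ ENNReal.ofReal (Real.exp (-(k * ε ^ 2 / 2))) := by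
  have he : 0 < 1 - ε ^ 2 := by nlinarith
  set c := ε ^ 2 / (1 - ε ^ 2) with hc
  have hc0 : 0 ≤ c := by positivity
  have hmp := measurePreserving_piFinSuccAbove (fun _ : Fin (k + 1) => gaussianReal 0 1) 0
  set S : Set (ℝ × (Fin k → ℝ)) := {q | c * ∑ i, q.2 i ^ 2 ≤ q.1 ^ 2} with hS
  have hSm : MeasurableSet S := by
    apply measurableSet_le <;> fun_prop
  have hset : {x : Fin (k + 1) → ℝ | ε ^ 2 * ∑ i, x i ^ 2 ≤ x 0 ^ 2} =
      (MeasurableEquiv.piFinSuccAbove (fun _ => ℝ) 0) ⁻¹' S := by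
    ext x
    simp only [Set.mem_ofPred_eq, Set.mem_preimage, hS, MeasurableEquiv.piFinSuccAbove_apply,
      Fin.sum_univ_succ, Fin.insertNthEquiv_symm_apply, Fin.removeNth_apply, Fin.zero_succAbove, hc]
    rw [div_mul_eq_mul_div, div_le_iff₀ he]
    constructor <;> intro h <;> nlinarith
  rw [hset, hmp.measure_preimage hSm.nullMeasurableSet, Measure.prod_apply_symm hSm]
  calc _ ≤ ∫⁻ y : Fin k → ℝ, ENNReal.ofReal (∏ i, Real.exp (-c * y i ^ 2 / 2))
          ∂(Measure.pi fun _ : Fin k => gaussianReal 0 1) := by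
        refine lintegral_mono fun y => ?_
        refine (aux_tail (t := c * ∑ i, y i ^ 2) (by positivity)).trans (le_of_eq ?_)
        rw [← Real.exp_sum, ← Finset.sum_div, ← Finset.mul_sum, neg_mul]
    _ = ENNReal.ofReal ((√(1 + c))⁻¹ ^ k) := by
        rw [← ofReal_integral_eq_lintegral_ofReal]
        · rw [integral_fintype_prod_eq_pow (ι := Fin k) (fun x : ℝ => Real.exp (-c * x ^ 2 / 2)),
            aux_mgf hc0]
          simp
        · apply Integrable.fintype_prod (f := fun _ (x : ℝ) => Real.exp (-c * x ^ 2 / 2))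
          intro i
          refine Integrable.of_bound (C := 1) (by fun_prop) (ae_of_all _ fun x => ?_)
          simp only [Real.norm_eq_abs, Real.abs_exp, Real.exp_le_one_iff]
          nlinarith [mul_nonneg hc0 (sq_nonneg x)]
        · exact ae_of_all _ fun x => by positivity
    _ ≤ _ := by
        apply ENNReal.ofReal_le_ofReal
        have : (√(1 + c))⁻¹ ≤ Real.exp (-(ε ^ 2 / 2)) := by
          have h2 : 1 + c = (1 - ε ^ 2)⁻¹ := by rw [hc]; field_simp; ring
          rw [h2, Real.sqrt_inv, inv_inv]
          rw [Real.sqrt_le_left (Real.exp_nonneg _), ← Real.exp_nat_mul]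
          have := Real.add_one_le_exp (-ε ^ 2)
          convert! (by linarith : 1 - ε ^ 2 ≤ Real.exp (-ε ^ 2)) using 2
          push_cast; ring
        calc _ ≤ Real.exp (-(ε ^ 2 / 2)) ^ k := by gcongr
          _ = _ := by rw [← Real.exp_nat_mul]; ring_nf

lemma aux_rot (k : ℕ) {ε : ℝ} (h0 : 0 < ε) (h1 : ε < 1) (y : Fin (k + 1) → ℝ) (hy : y ≠ 0) :
    (Measure.pi fun _ : Fin (k + 1) => gaussianReal 0 1)
      {x | ε ^ 2 * ((x ⬝ᵥ x) * (y ⬝ᵥ y)) ≤ (x ⬝ᵥ y) ^ 2}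
        ≤ ENNReal.ofReal (Real.exp (-(k * ε ^ 2 / 2))) := by
  set Y : EuclideanSpace ℝ (Fin (k + 1)) := WithLp.toLp 2 y with hY
  have hY0 : Y ≠ 0 := by simpa [hY] using hy
  have hYn : 0 < ‖Y‖ := norm_pos_iff.2 hY0
  obtain ⟨b, hb⟩ := Orthonormal.exists_orthonormalBasis_extension_of_card_eq (𝕜 := ℝ)
    (E := EuclideanSpace ℝ (Fin (k + 1))) (ι := Fin (k + 1)) (by simp)
    (v := fun _ => ‖Y‖⁻¹ • Y) (s := {0}) (by
      constructor
      · intro i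
        simp [norm_smul, hYn.ne']
      · intro i j hij
        exact absurd (Subsingleton.elim i j) hij)
  have hb0 : b 0 = ‖Y‖⁻¹ • Y := hb 0 rfl
  have hYb : Y = ‖Y‖ • b 0 := by rw [hb0, smul_smul, mul_inv_cancel₀ hYn.ne', one_smul]
  set T : Set (EuclideanSpace ℝ (Fin (k + 1))) :=
    {z | ε ^ 2 * (‖z‖ ^ 2 * ‖Y‖ ^ 2) ≤ (inner ℝ z Y) ^ 2} with hT
  have hTm : MeasurableSet T := by
    apply measurableSet_le <;> fun_prop
  have e1 := map_pi_eq_stdGaussian (ι := Fin (k + 1))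
  rw [stdGaussian_eq_map_pi_orthonormalBasis b] at e1
  have e2 := congrArg (fun ν => ν T) e1
  simp only at e2
  rw [Measure.map_apply (by fun_prop) hTm, Measure.map_apply (by fun_prop) hTm] at e2
  have s1 : {x | ε ^ 2 * ((x ⬝ᵥ x) * (y ⬝ᵥ y)) ≤ (x ⬝ᵥ y) ^ 2} =
      (WithLp.toLp 2 : (Fin (k + 1) → ℝ) → EuclideanSpace ℝ (Fin (k + 1))) ⁻¹' T := by
    ext x
    simp only [hT, Set.mem_ofPred_eq, Set.mem_preimage, EuclideanSpace.norm_sq_eq, hY,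
      Real.norm_eq_abs, sq_abs, dotProduct, PiLp.inner_apply, RCLike.inner_apply, conj_trivial]
    simp only [pow_two, mul_comm]
  rw [s1, e2]
  refine le_trans (measure_mono ?_) (aux_core k h0 h1)
  intro x hx
  simp only [hT, Set.mem_ofPred_eq, Set.mem_preimage] at hx ⊢
  have n1 : ‖∑ i, x i • b i‖ ^ 2 = ∑ i, x i ^ 2 := by
    rw [← real_inner_self_eq_norm_sq, b.orthonormal.inner_sum]
    simp [pow_two]
  have n2 : inner ℝ (∑ i, x i • b i) Y = ‖Y‖ * x 0 := by
    conv_lhs => rw [hYb]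
    rw [inner_smul_right, b.orthonormal.inner_left_fintype]
    simp
  rw [n1, n2] at hx
  have : 0 < ‖Y‖ ^ 2 := by positivity
  refine le_of_mul_le_mul_left ?_ this
  linarith

lemma aux_scale (k : ℕ) (v : ℝ≥0) (hv : v ≠ 0) {ε : ℝ} (h0 : 0 < ε) (h1 : ε < 1)
    (y : Fin (k + 1) → ℝ) (hy : y ≠ 0) :
    (Measure.pi fun _ : Fin (k + 1) => gaussianReal 0 v)
      {x | ε ^ 2 * ((x ⬝ᵥ x) * (y ⬝ᵥ y)) ≤ (x ⬝ᵥ y) ^ 2}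
        ≤ ENNReal.ofReal (Real.exp (-(k * ε ^ 2 / 2))) := by
  have hv' : 0 < (v : ℝ) := by positivity
  have e : (gaussianReal 0 v) = (gaussianReal 0 1).map (fun x => √(v : ℝ) * x) := by
    rw [gaussianReal_map_const_mul]
    congr 1
    · simp
    · ext
      simp
  have e2 : (Measure.pi fun _ : Fin (k + 1) => gaussianReal 0 v) =
      (Measure.pi fun _ : Fin (k + 1) => gaussianReal 0 1).map (fun x i => √(v : ℝ) * x i) := by
    have : ∀ i : Fin (k + 1), SigmaFinite
        ((gaussianReal 0 1).map (fun x => √(v : ℝ) * x)) := fun i => by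
      rw [← e]; infer_instance
    rw [Measure.pi_map_pi (by fun_prop), e]
  rw [e2, Measure.map_apply (by fun_prop) (by
    apply measurableSet_le <;> simp only [dotProduct] <;> fun_prop)]
  refine le_trans (measure_mono ?_) (aux_rot k h0 h1 y hy)
  intro x hx
  simp only [Set.mem_ofPred_eq, Set.mem_preimage] at hx ⊢
  have q : (fun i => √(v : ℝ) * x i) = √(v : ℝ) • x := rfl
  rw [q] at hx
  simp only [smul_dotProduct, dotProduct_smul, smul_eq_mul, mul_pow, Real.sq_sqrt hv'.le] at hx
  have hs := Real.mul_self_sqrt hv'.le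
  refine le_of_mul_le_mul_left ?_ hv'
  calc _ = ε ^ 2 * (√(v : ℝ) * (√(v : ℝ) * x ⬝ᵥ x) * y ⬝ᵥ y) := by
        linear_combination (-(ε ^ 2 * (x ⬝ᵥ x) * (y ⬝ᵥ y))) * hs
    _ ≤ _ := hx

lemma aux_pair (k n : ℕ) (v : ℝ≥0) (hv : v ≠ 0) {ε : ℝ} (h0 : 0 < ε) (h1 : ε < 1)
    (j l : Fin n) (hjl : j ≠ l) :
    (Measure.pi fun _ : Fin (k + 1) × Fin n => gaussianReal 0 v)
      {ω | ε ≤ |(fun i => ω (i, j)) ⬝ᵥ (fun i => ω (i, l))| /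
        (Real.sqrt ((fun i => ω (i, j)) ⬝ᵥ (fun i => ω (i, j))) *
         Real.sqrt ((fun i => ω (i, l)) ⬝ᵥ (fun i => ω (i, l))))}
        ≤ ENNReal.ofReal (Real.exp (-(k * ε ^ 2 / 2))) := by
  set P := (Measure.pi fun _ : Fin (k + 1) × Fin n => gaussianReal 0 v) with hP
  set Q := (Measure.pi fun _ : Fin (k + 1) => gaussianReal 0 v) with hQ
  let g : Fin (k + 1) ⊕ Fin (k + 1) → Fin (k + 1) × Fin n :=
    Sum.elim (fun i => (i, j)) (fun i => (i, l))
  have hg : Function.Injective g := by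
    rintro (a | a) (b | b) h <;> simp [g] at h
    · rw [h]
    · exact absurd h.2 hjl
    · exact absurd h.2.symm hjl
    · rw [h]
  have hind : iIndepFun (fun (p : Fin (k + 1) × Fin n) (ω : Fin (k + 1) × Fin n → ℝ) => ω p) P :=
    iIndepFun_pi (X := fun _ x => x) (fun _ => by fun_prop)
  have hmap := (iIndepFun_iff_map_fun_eq_pi_map
    (fun i => (measurable_pi_apply (g i)).aemeasurable)).1 (hind.precomp hg)
  have hev : ∀ p, P.map (fun ω => ω p) = gaussianReal 0 v := fun p =>
    (measurePreserving_eval (fun _ : Fin (k + 1) × Fin n => gaussianReal 0 v) p).map_eq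
  simp_rw [hev] at hmap
  have hmp1 : MeasurePreserving (fun (ω : Fin (k + 1) × Fin n → ℝ) i => ω (g i)) P
      (Measure.pi fun _ => gaussianReal 0 v) := ⟨by fun_prop, hmap⟩
  have hmp := (measurePreserving_sumPiEquivProdPi
    (fun _ : Fin (k + 1) ⊕ Fin (k + 1) => gaussianReal 0 v)).comp hmp1
  set S : Set ((Fin (k + 1) → ℝ) × (Fin (k + 1) → ℝ)) :=
    {q | ε ≤ |q.1 ⬝ᵥ q.2| / (√(q.1 ⬝ᵥ q.1) * √(q.2 ⬝ᵥ q.2))} with hS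
  have hSm : MeasurableSet S := by
    apply measurableSet_le
    · fun_prop
    · simp only [dotProduct]; fun_prop
  have := hmp.measure_preimage hSm.nullMeasurableSet
  refine (le_of_eq this).trans ?_
  rw [Measure.prod_apply_symm hSm]
  calc _ ≤ ∫⁻ y : Fin (k + 1) → ℝ, ENNReal.ofReal (Real.exp (-(k * ε ^ 2 / 2))) ∂Q := by
        refine lintegral_mono fun y => ?_
        by_cases hy : y = 0
        · have : (fun x => (x, y)) ⁻¹' S = ∅ := by
            ext x
            simp [hS, hy, h0]
          rw [this]; simp
        · refine le_trans (measure_mono ?_) (aux_scale k v hv h0 h1 y hy)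
          intro x hx
          simp only [hS, Set.mem_ofPred_eq, Set.mem_preimage] at hx ⊢
          have hxx : 0 ≤ x ⬝ᵥ x := by
            exact Finset.sum_nonneg fun i (_ : i ∈ Finset.univ) => mul_self_nonneg (x i)
          have hyy : 0 ≤ y ⬝ᵥ y := by
            exact Finset.sum_nonneg fun i (_ : i ∈ Finset.univ) => mul_self_nonneg (y i)
          have hd : 0 < √(x ⬝ᵥ x) * √(y ⬝ᵥ y) := by
            by_contra hcon
            have : √(x ⬝ᵥ x) * √(y ⬝ᵥ y) = 0 := le_antisymm (not_lt.1 hcon) (by positivity)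
            rw [this, div_zero] at hx
            linarith
          rw [le_div_iff₀ hd] at hx
          have := pow_le_pow_left₀ (by positivity) hx 2
          rwa [mul_pow, mul_pow, Real.sq_sqrt hxx, Real.sq_sqrt hyy, sq_abs] at this
    _ = _ := by simp

lemma aux_gen {m n : ℕ} (hn : 2 ≤ n) {ε a : ℝ} (hε : 0 < ε) (ha : 0 < a)
    {Ω : Type*} [MeasurableSpace Ω] (μ : Measure Ω)
    (A : Ω → Fin m → Fin n → ℝ) (hA : Measurable A) (j₀ k₀ : Fin n)
    (hex : ∀ j k : Fin n, j ≠ k →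
        Measure.map (fun ω => ((fun i => A ω i j), (fun i => A ω i k))) μ =
          Measure.map (fun ω => ((fun i => A ω i j₀), (fun i => A ω i k₀))) μ) :
      μ {ω | ε ≤ mutualCoherence (Matrix.of (A ω))} ≤
        ((n : ℝ≥0∞) * (n - 1) / 2) *
          (μ {ω | a * ε ≤ |(fun i => A ω i j₀) ⬝ᵥ (fun i => A ω i k₀)|} +
           2 * μ {ω | (fun i => A ω i j₀) ⬝ᵥ (fun i => A ω i j₀) ≤ a}) := by
  have hAm : ∀ i j, Measurable (fun ω => A ω i j) := fun i j => by fun_prop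
  have hpm : ∀ j k : Fin n, Measurable
      (fun ω => ((fun i => A ω i j), (fun i => A ω i k)) : Ω → (Fin m → ℝ) × (Fin m → ℝ)) := by
    intro j k
    fun_prop
  have tr : ∀ j k : Fin n, j ≠ k → ∀ S : Set ((Fin m → ℝ) × (Fin m → ℝ)), MeasurableSet S →
      μ {ω | ((fun i => A ω i j), (fun i => A ω i k)) ∈ S} =
      μ {ω | ((fun i => A ω i j₀), (fun i => A ω i k₀)) ∈ S} := by
    intro j k hjk S hS
    have := congrArg (fun ν => ν S) (hex j k hjk)
    rwa [Measure.map_apply (hpm j k) hS, Measure.map_apply (hpm j₀ k₀) hS] at this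
  have t1 : ∀ j k : Fin n, j ≠ k → μ {ω | a * ε ≤ |(fun i => A ω i j) ⬝ᵥ (fun i => A ω i k)|} =
      μ {ω | a * ε ≤ |(fun i => A ω i j₀) ⬝ᵥ (fun i => A ω i k₀)|} := fun j k hjk =>
    tr j k hjk {q | a * ε ≤ |q.1 ⬝ᵥ q.2|} (by
      apply measurableSet_le
      · fun_prop
      · simp only [dotProduct]; fun_prop)
  have t2 : ∀ j k : Fin n, j ≠ k → μ {ω | (fun i => A ω i j) ⬝ᵥ (fun i => A ω i j) ≤ a} =
      μ {ω | (fun i => A ω i j₀) ⬝ᵥ (fun i => A ω i j₀) ≤ a} := fun j k hjk =>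
    tr j k hjk {q | q.1 ⬝ᵥ q.1 ≤ a} (by
      apply measurableSet_le
      · simp only [dotProduct]; fun_prop
      · fun_prop)
  refine aux_union hn μ (fun ω => Matrix.of (A ω)) _ ?_
  intro j k hjk
  rw [two_mul, ← t1 j k hjk.ne]
  nth_rewrite 1 [← t2 j k hjk.ne]
  rw [← t2 k j hjk.ne']
  refine le_trans (measure_mono ?_) ((measure_union_le _ _).trans
    (add_le_add le_rfl (measure_union_le _ _)))
  intro ω hω
  simp only [Set.mem_union, Set.mem_ofPred_eq, Matrix.of_apply] at hω ⊢
  by_contra! hcon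
  obtain ⟨c1, c2, c3⟩ := hcon
  have s2 := Real.sqrt_lt_sqrt ha.le c2
  have s3 := Real.sqrt_lt_sqrt ha.le c3
  have s0 := Real.sqrt_pos.2 ha
  have hd : a ≤ √((fun i => A ω i j) ⬝ᵥ fun i => A ω i j) *
      √((fun i => A ω i k) ⬝ᵥ fun i => A ω i k) := by
    calc a = √a * √a := (Real.mul_self_sqrt ha.le).symm
      _ ≤ _ := by gcongr
  rw [le_div_iff₀ (ha.trans_le hd)] at hω
  nlinarith

/-- Union bound for the coherence: if the pairs of columns of a random matrix
are exchangeable, then for `ε, a ∈ (0,1)`,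
`P(μ(A) ≥ ε) ≤ (n(n−1)/2)[P(|⟨α_{j₀},α_{k₀}⟩| ≥ aε) + 2 P(‖α_{j₀}‖² ≤ a)]`; and for the
Gaussian random matrix with i.i.d. `N(0,1/m)` entries,
`P(μ(A) ≥ ε) ≤ (n(n−1)/2)[exp(−ma²ε²/(4(1+aε/2))) + exp(−m(1−a)²/4)]`. -/
theorem stmt18 (m n : ℕ) (hm : 0 < m) (hmn : m < n)
    (ε a : ℝ) (hε : ε ∈ Set.Ioo (0 : ℝ) 1) (ha : a ∈ Set.Ioo (0 : ℝ) 1) :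
    (∀ (Ω : Type) (_ : MeasurableSpace Ω) (μ : Measure Ω), IsProbabilityMeasure μ →
      ∀ (A : Ω → Fin m → Fin n → ℝ), Measurable A →
      ∀ j₀ k₀ : Fin n, j₀ ≠ k₀ →
      (∀ j k : Fin n, j ≠ k →
        Measure.map (fun ω => ((fun i => A ω i j), (fun i => A ω i k))) μ =
          Measure.map (fun ω => ((fun i => A ω i j₀), (fun i => A ω i k₀))) μ) →
      μ {ω | ε ≤ mutualCoherence (Matrix.of (A ω))} ≤
        ((n : ℝ≥0∞) * (n - 1) / 2) *
          (μ {ω | a * ε ≤ |(fun i => A ω i j₀) ⬝ᵥ (fun i => A ω i k₀)|} +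
           2 * μ {ω | (fun i => A ω i j₀) ⬝ᵥ (fun i => A ω i j₀) ≤ a})) ∧
    ((Measure.pi fun _ : Fin m × Fin n => gaussianReal 0 (m : ℝ≥0)⁻¹)
        {ω | ε ≤ mutualCoherence (Matrix.of fun i j => ω (i, j))} ≤
      ENNReal.ofReal ((n : ℝ) * (n - 1) / 2 *
        (Real.exp (-(m : ℝ) * a ^ 2 * ε ^ 2 / (4 * (1 + a * ε / 2))) +
         Real.exp (-(m : ℝ) * (1 - a) ^ 2 / 4)))) := by
  have hn : 2 ≤ n := by omega
  obtain ⟨e0, e1⟩ := hε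
  obtain ⟨a0, a1⟩ := ha
  refine ⟨fun Ω _ μ _ A hA j₀ k₀ _ hex => aux_gen hn e0 a0 μ A hA j₀ k₀ hex, ?_⟩
  have hfac : (n : ℝ≥0∞) * (n - 1) / 2 = ENNReal.ofReal ((n : ℝ) * (n - 1) / 2) := by
    rw [ENNReal.ofReal_div_of_pos (by norm_num), ENNReal.ofReal_mul (by positivity),
      ENNReal.ofReal_sub _ (by norm_num)]
    simp
  have hn1 : (0 : ℝ) ≤ (n : ℝ) * (n - 1) / 2 := by
    have : (2 : ℝ) ≤ n := by exact_mod_cast hn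
    have : (0 : ℝ) ≤ n - 1 := by linarith
    positivity
  rw [ENNReal.ofReal_mul hn1, ← hfac]
  refine aux_union hn _ (fun ω : Fin m × Fin n → ℝ => Matrix.of fun i j => ω (i, j)) _ ?_
  intro j l hjl
  obtain ⟨k, rfl⟩ : ∃ k, m = k + 1 := ⟨m - 1, by omega⟩
  simp only [Matrix.of_apply]
  have hae : 0 < a * ε := by positivity
  have hae1 : a * ε ≤ ε := by nlinarith
  have hsq : (a * ε) ^ 2 ≤ ε ^ 2 := by gcongr
  rcases Nat.eq_zero_or_pos k with rfl | hk
  · refine prob_le_one.trans ?_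
    rw [← ENNReal.ofReal_one]
    apply ENNReal.ofReal_le_ofReal
    have b1 := Real.add_one_le_exp
      (-((0 + 1 : ℕ) : ℝ) * a ^ 2 * ε ^ 2 / (4 * (1 + a * ε / 2)))
    have b2 := Real.add_one_le_exp (-((0 + 1 : ℕ) : ℝ) * (1 - a) ^ 2 / 4)
    have b3 : -(1 / 4) ≤ -((0 + 1 : ℕ) : ℝ) * a ^ 2 * ε ^ 2 / (4 * (1 + a * ε / 2)) := by
      rw [le_div_iff₀ (by positivity)]
      push_cast
      nlinarith
    have b4 : -(1 / 4) ≤ -((0 + 1 : ℕ) : ℝ) * (1 - a) ^ 2 / 4 := by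
      push_cast
      nlinarith
    linarith
  · refine (aux_pair k n _ (by positivity) e0 e1 j l hjl.ne).trans ?_
    apply ENNReal.ofReal_le_ofReal
    have : Real.exp (-(k * ε ^ 2 / 2)) ≤
        Real.exp (-((k + 1 : ℕ) : ℝ) * a ^ 2 * ε ^ 2 / (4 * (1 + a * ε / 2))) := by
      apply Real.exp_le_exp.2
      rw [le_div_iff₀ (by positivity)]
      have hk' : (1 : ℝ) ≤ k := by exact_mod_cast hk
      push_cast
      have c1 : ((k : ℝ) + 1) * (a * ε) ^ 2 ≤ (2 * k) * ε ^ 2 := by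
        gcongr
        linarith
      have c2 : 0 ≤ k * ε ^ 2 * (a * ε) := by positivity
      nlinarith
    have := Real.exp_pos (-((k + 1 : ℕ) : ℝ) * (1 - a) ^ 2 / 4)
    linarith
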